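/- Let u and v be inner functions on the open unit disk. Then (a) every constant function belongs to the multiplier space 𝓜(u,v) (equivalently ℂ ⊆ 𝓜(u,v)) if and only if u divides v, i.e., v = uI for some inner function I; and (b) if u divides v and u is not a unimodular constant multiple of v, then 𝓜(v,u) = {0}. -/

import Mathlib

open Complex MeasureTheory Metric Filter Set Topology

noncomputable section

/-- The `n`-th Taylor coefficient of `f` at `0`. -/
def hcoeff (f : ℂ → ℂ) (n : ℕ) : ℂ := iteratedDeriv n f 0 / n.factorial

/-- Membership in the Hardy space `H²` of the open unit disk, described via
square-summability of the Taylor coefficients. -/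
def MemH2 (f : ℂ → ℂ) : Prop :=
  DifferentiableOn ℂ f (ball (0 : ℂ) 1) ∧ Summable fun n => ‖hcoeff f n‖ ^ 2

/-- The `H²` inner product, conjugate-linear in the first variable. -/
def hInner (f g : ℂ → ℂ) : ℂ := ∑' n : ℕ, (starRingEnd ℂ) (hcoeff f n) * hcoeff g n

/-- The squared `H²` norm. -/
def hNormSq (f : ℂ → ℂ) : ℝ := ∑' n : ℕ, ‖hcoeff f n‖ ^ 2

/-- Membership in `H^∞`: bounded analytic functions on the disk. -/
def MemHinf (f : ℂ → ℂ) : Prop :=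
  DifferentiableOn ℂ f (ball (0 : ℂ) 1) ∧ ∃ C : ℝ, ∀ z ∈ ball (0 : ℂ) 1, ‖f z‖ ≤ C

/-- An inner function: bounded analytic on the disk with unimodular radial
boundary values almost everywhere. -/
def IsInner (u : ℂ → ℂ) : Prop :=
  MemHinf u ∧
    ∀ᵐ θ : ℝ, ∃ L : ℂ, ‖L‖ = 1 ∧
      Tendsto (fun r : ℝ => u ((r : ℂ) * Complex.exp ((θ : ℂ) * Complex.I)))
        (𝓝[<] (1 : ℝ)) (𝓝 L)

/-- The model space `K_Θ = H² ⊖ Θ H²`: elements of `H²` orthogonal to `Θ H²`. -/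
def KSpace (Θ : ℂ → ℂ) : Set (ℂ → ℂ) :=
  {f | MemH2 f ∧ ∀ g : ℂ → ℂ, MemH2 g → hInner (fun z => Θ z * g z) f = 0}

/-- The multiplier space `𝓜(u, v) = {φ analytic on 𝔻 : φ · K_u ⊆ K_v}`. -/
def Mult (u v : ℂ → ℂ) : Set (ℂ → ℂ) :=
  {φ | DifferentiableOn ℂ φ (ball (0 : ℂ) 1) ∧
    ∀ f ∈ KSpace u, (fun z => φ z * f z) ∈ KSpace v}

/-- Radial boundary value of `f` at the point `e^{iθ}` of the unit circle. -/
def bdry (f : ℂ → ℂ) (θ : ℝ) : ℂ :=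
  limUnder (𝓝[<] (1 : ℝ)) fun r : ℝ => f ((r : ℂ) * Complex.exp ((θ : ℂ) * Complex.I))

/-- The kernel of the Toeplitz operator `T_{conj(z v) u}` on `H²`:
those `φ ∈ H²` with `P₊(conj(z v) u φ) = 0`, i.e. `conj(z v) u φ ⟂ H²`
in `L²` of the circle. -/
def kerToeplitzZVU (u v : ℂ → ℂ) : Set (ℂ → ℂ) :=
  {φ | MemH2 φ ∧ ∀ h : ℂ → ℂ, MemH2 h →
    (∫ θ in (0 : ℝ)..(2 * Real.pi),
      (starRingEnd ℂ) (Complex.exp ((θ : ℂ) * Complex.I) * bdry v θ) * bdry u θ * bdry φ θ *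
        (starRingEnd ℂ) (bdry h θ)) = 0}

/-- `|φ|² dm` is a Carleson measure for `K_u`. -/
def IsCarlesonForK (u φ : ℂ → ℂ) : Prop :=
  ∃ C : ℝ, ∀ f ∈ KSpace u,
    (∫ θ in (0 : ℝ)..(2 * Real.pi), ‖bdry f θ‖ ^ 2 * ‖bdry φ θ‖ ^ 2) ≤ C * hNormSq f

/-- The backward shift `(S^* f)(z) = (f(z) - f(0))/z`. -/
def bShift (f : ℂ → ℂ) : ℂ → ℂ := fun z =>
  if z = 0 then deriv f 0 else (f z - f 0) / z

/-- The reproducing kernel of the model space `K_Θ`. -/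
def repKer (Θ : ℂ → ℂ) (lam : ℂ) : ℂ → ℂ := fun z =>
  (1 - (starRingEnd ℂ) (Θ lam) * Θ z) / (1 - (starRingEnd ℂ) lam * z)

/-- A single Blaschke factor with zero at `a ∈ 𝔻`. -/
def blaschkeFactor (a : ℂ) : ℂ → ℂ := fun z =>
  if a = 0 then z else ((‖a‖ : ℂ) / a) * ((a - z) / (1 - (starRingEnd ℂ) a * z))

/-- A finite Blaschke product (on the disk). -/
def IsFiniteBlaschke (B : ℂ → ℂ) : Prop :=
  ∃ (c : ℂ) (N : ℕ) (a : Fin N → ℂ), ‖c‖ = 1 ∧ (∀ i, a i ∈ ball (0 : ℂ) 1) ∧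
    ∀ z ∈ ball (0 : ℂ) 1, B z = c * ∏ i, blaschkeFactor (a i) z

/-- The boundary spectrum `σ(u) = {ξ ∈ 𝕋 : liminf_{z → ξ, z ∈ 𝔻} |u(z)| = 0}`. -/
def bdrySpec (u : ℂ → ℂ) : Set ℂ :=
  {ξ | ‖ξ‖ = 1 ∧ Filter.liminf (fun z => ‖u z‖) (𝓝[ball (0 : ℂ) 1] ξ) = 0}

/-- An outer function:
`F(z) = c · exp(∫_𝕋 (ξ+z)/(ξ-z) log w(ξ) dm(ξ))` for a unimodular constant `c`
and a nonnegative weight `w` with `log w ∈ L¹`. -/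
def IsOuter (F : ℂ → ℂ) : Prop :=
  ∃ (c : ℂ) (w : ℝ → ℝ), ‖c‖ = 1 ∧ (∀ θ, 0 ≤ w θ) ∧
    IntervalIntegrable (fun θ => |Real.log (w θ)|) volume 0 (2 * Real.pi) ∧
    ∀ z ∈ ball (0 : ℂ) 1,
      F z = c * Complex.exp ((2 * (Real.pi : ℂ))⁻¹ *
        ∫ θ in (0 : ℝ)..(2 * Real.pi),
          ((Complex.exp ((θ : ℂ) * Complex.I) + z) /
              (Complex.exp ((θ : ℂ) * Complex.I) - z)) * (Real.log (w θ) : ℂ))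

/-- The sequence space `ℓ²`, a model of `H²` through Taylor coefficients. -/
abbrev SeqH2 : Type := lp (fun _ : ℕ => ℂ) 2

/-- The power series with coefficients `a`. -/
def powerEval (a : SeqH2) (z : ℂ) : ℂ := ∑' n : ℕ, a n * z ^ n

lemma hcoeff_congr {f g : ℂ → ℂ} (h : EqOn f g (ball 0 1)) : hcoeff f = hcoeff g := by
  funext n
  have : f =ᶠ[𝓝 0] g := h.eventuallyEq_of_mem (ball_mem_nhds 0 one_pos)
  rw [hcoeff, hcoeff, this.iteratedDeriv_eq]

lemma hasSum_hcoeff {f : ℂ → ℂ} (hf : DifferentiableOn ℂ f (ball 0 1)) {z : ℂ}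
    (hz : z ∈ ball (0 : ℂ) 1) : HasSum (fun n => hcoeff f n * z ^ n) (f z) := by
  have h := Complex.hasSum_taylorSeries_on_ball (r := 1) (c := 0) (f := f)
    (by simpa using hf) (by simpa using hz)
  have heq : (fun n => hcoeff f n * z ^ n) =
      fun n : ℕ => (n.factorial : ℂ)⁻¹ • (z - 0) ^ n • iteratedDeriv n f 0 := by
    funext n
    simp only [hcoeff, sub_zero, smul_eq_mul]
    ring
  rw [heq]
  exact h

lemma hcoeff_eq_of_hasSum {f : ℂ → ℂ} (hf : DifferentiableOn ℂ f (ball 0 1)) {a : ℕ → ℂ}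
    (h : ∀ z ∈ ball (0 : ℂ) 1, HasSum (fun n => a n * z ^ n) (f z)) : hcoeff f = a := by
  have key : ∀ b : ℕ → ℂ, (∀ z ∈ ball (0 : ℂ) 1, HasSum (fun n => b n * z ^ n) (f z)) →
      HasFPowerSeriesAt f (FormalMultilinearSeries.ofScalars ℂ b) 0 := by
    intro b hb
    rw [hasFPowerSeriesAt_iff]
    filter_upwards [ball_mem_nhds (0 : ℂ) one_pos] with z hz
    simpa [FormalMultilinearSeries.coeff_ofScalars, mul_comm] using hb z hz
  have h1 := (key _ (fun z hz => hasSum_hcoeff hf hz)).eq_formalMultilinearSeries (key a h)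
  funext n
  simpa [FormalMultilinearSeries.coeff_ofScalars] using
    congrArg (fun p => FormalMultilinearSeries.coeff p n) h1

lemma summable_powerEval (a : SeqH2) {z : ℂ} (hz : z ∈ ball (0 : ℂ) 1) :
    Summable fun n => a n * z ^ n := by
  have hz' : ‖z‖ < 1 := by simpa using hz
  refine Summable.of_norm_bounded (g := fun n => ‖a‖ * ‖z‖ ^ n)
    ((summable_geometric_of_lt_one (norm_nonneg _) hz').mul_left _) fun n => ?_
  rw [norm_mul, norm_pow]
  gcongr
  exact lp.norm_apply_le_norm (by simp) a n

lemma hasSum_powerEval (a : SeqH2) {z : ℂ} (hz : z ∈ ball (0 : ℂ) 1) :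
    HasSum (fun n => a n * z ^ n) (powerEval a z) :=
  (summable_powerEval a hz).hasSum

lemma differentiableOn_powerEval (a : SeqH2) : DifferentiableOn ℂ (powerEval a) (ball 0 1) := by
  intro z hz
  obtain ⟨r, hzr, hr⟩ := exists_between (show ‖z‖ < 1 by simpa using hz)
  have hr0 : 0 ≤ r := (norm_nonneg z).trans hzr.le
  have : DifferentiableOn ℂ (powerEval a) (ball 0 r) := by
    refine Complex.differentiableOn_tsum_of_summable_norm (u := fun n => ‖a‖ * r ^ n)
      ((summable_geometric_of_lt_one hr0 hr).mul_left _) (fun n => by fun_prop) isOpen_ball ?_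
    intro n w hw
    have hw' : ‖w‖ < r := by simpa using hw
    rw [norm_mul, norm_pow]
    gcongr
    exact lp.norm_apply_le_norm (by simp) a n
  exact (this.differentiableAt (isOpen_ball.mem_nhds (by simpa using hzr))).differentiableWithinAt

lemma hcoeff_powerEval (a : SeqH2) : hcoeff (powerEval a) = a :=
  hcoeff_eq_of_hasSum (differentiableOn_powerEval a) fun _ hz => hasSum_powerEval a hz

lemma hcoeff_eq_of_eqOn {f : ℂ → ℂ} {a : SeqH2} (h : EqOn (powerEval a) f (ball 0 1)) :
    hcoeff f = a := by
  rw [← hcoeff_congr h, hcoeff_powerEval]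

lemma powerEval_injOn {a b : SeqH2} (h : EqOn (powerEval a) (powerEval b) (ball 0 1)) : a = b :=
  lp.ext ((hcoeff_eq_of_eqOn h).symm.trans (hcoeff_powerEval b))

lemma powerEval_add (a b : SeqH2) {z : ℂ} (hz : z ∈ ball (0 : ℂ) 1) :
    powerEval (a + b) z = powerEval a z + powerEval b z := by
  rw [powerEval, powerEval, powerEval,
    ← (summable_powerEval a hz).tsum_add (summable_powerEval b hz)]
  simp [add_mul]

lemma powerEval_smul (c : ℂ) (a : SeqH2) (z : ℂ) :
    powerEval (c • a) z = c * powerEval a z := by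
  simp [powerEval, ← tsum_mul_left, mul_assoc]

lemma powerEval_sub (a b : SeqH2) {z : ℂ} (hz : z ∈ ball (0 : ℂ) 1) :
    powerEval (a - b) z = powerEval a z - powerEval b z := by
  have h := powerEval_add (a - b) b hz
  rw [sub_add_cancel] at h
  rw [h, add_sub_cancel_right]

lemma powerEval_single (n : ℕ) (c z : ℂ) : powerEval (lp.single 2 n c) z = c * z ^ n := by
  rw [powerEval, tsum_eq_single n]
  · simp
  · intro m hm
    rw [lp.single_apply_ne _ _ _ hm, zero_mul]

lemma powerEval_zero (a : SeqH2) : powerEval a 0 = a 0 := by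
  rw [powerEval, tsum_eq_single 0]
  · simp
  · intro m hm
    simp [hm]

lemma memH2_powerEval (a : SeqH2) : MemH2 (powerEval a) := by
  refine ⟨differentiableOn_powerEval a, ?_⟩
  rw [hcoeff_powerEval]
  have := (lp.memℓp a).summable (by simp)
  simpa using this

lemma MemH2.exists_powerEval {f : ℂ → ℂ} (hf : MemH2 f) :
    ∃ a : SeqH2, EqOn (powerEval a) f (ball 0 1) := by
  have hm : Memℓp (hcoeff f) 2 := (memℓp_gen_iff (by simp)).2 (by simpa using hf.2)
  exact ⟨⟨hcoeff f, hm⟩, fun z hz => (hasSum_hcoeff hf.1 hz).tsum_eq⟩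

lemma memH2_of_eqOn {f : ℂ → ℂ} {a : SeqH2} (h : EqOn (powerEval a) f (ball 0 1)) : MemH2 f := by
  refine ⟨(differentiableOn_powerEval a).congr fun z hz => (h hz).symm, ?_⟩
  rw [← hcoeff_congr h]
  exact (memH2_powerEval a).2

lemma hInner_eq_inner {f g : ℂ → ℂ} {a b : SeqH2} (ha : EqOn (powerEval a) f (ball 0 1))
    (hb : EqOn (powerEval b) g (ball 0 1)) : hInner f g = inner ℂ a b := by
  rw [hInner, hcoeff_eq_of_eqOn ha, hcoeff_eq_of_eqOn hb, lp.inner_eq_tsum]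
  simp [mul_comm]

lemma hasSum_norm_sq (a : SeqH2) : HasSum (fun n => ‖a n‖ ^ 2) (‖a‖ ^ 2) := by
  simpa using lp.hasSum_norm (p := 2) (by simp) a

/-- The mean of `‖f‖ ^ 2` over the circle of radius `r`. -/
def circleMeanSq (r : ℝ) (f : ℂ → ℂ) : ℝ :=
  (2 * Real.pi)⁻¹ * ∫ θ in (0 : ℝ)..(2 * Real.pi), ‖f (r * Complex.exp (θ * Complex.I))‖ ^ 2

lemma mul_exp_mem_ball {r : ℝ} (hr0 : 0 ≤ r) (hr : r < 1) (θ : ℝ) :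
    (r : ℂ) * Complex.exp (θ * Complex.I) ∈ ball (0 : ℂ) 1 := by
  simpa [Complex.norm_exp_ofReal_mul_I, abs_of_nonneg hr0] using hr

lemma continuous_circle {f : ℂ → ℂ} (hf : DifferentiableOn ℂ f (ball 0 1)) {r : ℝ}
    (hr0 : 0 ≤ r) (hr : r < 1) :
    Continuous fun θ : ℝ => f (r * Complex.exp (θ * Complex.I)) :=
  hf.continuousOn.comp_continuous (by fun_prop) fun θ => mul_exp_mem_ball hr0 hr θ

lemma integral_exp_mul_conj_exp (n m : ℕ) :
    ∫ θ in (0 : ℝ)..(2 * Real.pi), Complex.exp (θ * Complex.I) ^ n *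
      (starRingEnd ℂ) (Complex.exp (θ * Complex.I) ^ m) = if m = n then (2 * Real.pi : ℂ) else 0 := by
  have h : ∀ θ : ℝ, Complex.exp (θ * Complex.I) ^ n *
      (starRingEnd ℂ) (Complex.exp (θ * Complex.I) ^ m) =
      Complex.exp ((((n : ℂ) - m) * Complex.I) * θ) := by
    intro θ
    rw [map_pow, ← Complex.exp_conj, ← Complex.exp_nat_mul, ← Complex.exp_nat_mul,
      ← Complex.exp_add]
    congr 1
    simp
    ring
  simp_rw [h]
  split_ifs with hmn
  · simp [hmn]
  · have hne : ((n : ℂ) - m) ≠ 0 := sub_ne_zero.2 (by exact_mod_cast Ne.symm hmn)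
    rw [integral_exp_mul_complex (mul_ne_zero hne Complex.I_ne_zero)]
    have : Complex.exp ((((n : ℂ) - m) * Complex.I) * ((2 * Real.pi : ℝ) : ℂ)) = 1 := by
      rw [Complex.exp_eq_one_iff]
      exact ⟨(n : ℤ) - m, by push_cast; ring⟩
    rw [this]
    simp

lemma hasSum_integral_mul_powers {c : ℕ → ℂ} (hc : Summable fun n => ‖c n‖) {F g : ℝ → ℂ}
    {e : ℕ → ℝ → ℂ} (he : ∀ n, Continuous (e n)) (he1 : ∀ n θ, ‖e n θ‖ = 1)
    (hg : Continuous g) (hF : ∀ θ, HasSum (fun n => c n * e n θ) (F θ)) :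
    HasSum (fun n => c n * ∫ θ in (0 : ℝ)..(2 * Real.pi), e n θ * g θ)
      (∫ θ in (0 : ℝ)..(2 * Real.pi), F θ * g θ) := by
  have h := intervalIntegral.hasSum_integral_of_dominated_convergence (μ := volume)
    (a := 0) (b := 2 * Real.pi) (F := fun n θ => c n * e n θ * g θ) (f := fun θ => F θ * g θ)
    (fun n θ => ‖c n‖ * ‖g θ‖)
    (fun n => ((continuous_const.mul (he n)).mul hg).aestronglyMeasurable)
    (fun n => ae_of_all _ fun θ _ => by simp [he1])
    (ae_of_all _ fun θ _ => hc.mul_right _)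
    (by
      simp_rw [tsum_mul_right]
      exact (continuous_const.mul hg.norm).intervalIntegrable _ _)
    (ae_of_all _ fun θ _ => (hF θ).mul_right _)
  simpa only [mul_assoc, intervalIntegral.integral_const_mul] using h

/-- Parseval's identity on the circle of radius `r < 1`. -/
lemma hasSum_circleMeanSq {f : ℂ → ℂ} (hf : DifferentiableOn ℂ f (ball 0 1)) {r : ℝ}
    (hr0 : 0 ≤ r) (hr : r < 1) :
    HasSum (fun n => ‖hcoeff f n‖ ^ 2 * (r ^ n) ^ 2) (circleMeanSq r f) := by
  set c : ℕ → ℂ := fun n => hcoeff f n * r ^ n with hc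
  set F : ℝ → ℂ := fun θ => f (r * Complex.exp (θ * Complex.I)) with hF
  set e : ℕ → ℝ → ℂ := fun n θ => Complex.exp (θ * Complex.I) ^ n with he
  have hFc : Continuous F := continuous_circle hf hr0 hr
  have hec : ∀ n, Continuous (e n) := fun n => by fun_prop
  have he1 : ∀ n θ, ‖e n θ‖ = 1 := fun n θ => by simp [he, Complex.norm_exp_ofReal_mul_I]
  have hsum : Summable fun n => ‖c n‖ := by
    have := (hasSum_hcoeff hf (z := r) (by simpa [abs_of_nonneg hr0] using hr)).summable
    exact this.norm
  have hFs : ∀ θ, HasSum (fun n => c n * e n θ) (F θ) := fun θ => by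
    have := hasSum_hcoeff hf (mul_exp_mem_ball hr0 hr θ)
    simpa [hc, he, hF, mul_pow, mul_assoc] using this
  have hinner : ∀ n, ∫ θ in (0 : ℝ)..(2 * Real.pi), e n θ * (starRingEnd ℂ) (F θ) =
      (starRingEnd ℂ) (c n) * (2 * Real.pi) := by
    intro n
    have h := hasSum_integral_mul_powers (c := fun m => (starRingEnd ℂ) (c m)) (g := e n)
      (F := fun θ => (starRingEnd ℂ) (F θ)) (e := fun m θ => (starRingEnd ℂ) (e m θ))
      (by simpa using hsum) (fun m => Complex.continuous_conj.comp (hec m))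
      (fun m θ => by simpa using he1 m θ) (hec n)
      (fun θ => by simpa using Complex.hasSum_conj'.2 (hFs θ))
    have h2 := h.tsum_eq
    rw [tsum_eq_single n] at h2
    · simp_rw [mul_comm (e n _)]
      rw [← h2]
      congr 1
      have := integral_exp_mul_conj_exp n n
      simp only [if_true] at this
      rw [← this]
      exact intervalIntegral.integral_congr fun θ _ => mul_comm _ _
    · intro m hm
      have := integral_exp_mul_conj_exp n m
      rw [if_neg hm] at this
      rw [mul_eq_zero]
      right
      rw [← this]
      exact intervalIntegral.integral_congr fun θ _ => mul_comm _ _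
  have h := hasSum_integral_mul_powers hsum hec he1
    (Complex.continuous_conj.comp hFc) hFs
  simp only [Function.comp_apply, hinner] at h
  have h3 := h.mul_left ((2 * Real.pi : ℂ)⁻¹)
  rw [← Complex.hasSum_ofReal]
  have hmean : (circleMeanSq r f : ℂ) =
      (2 * Real.pi : ℂ)⁻¹ * ∫ θ in (0 : ℝ)..(2 * Real.pi), F θ * (starRingEnd ℂ) (F θ) := by
    rw [circleMeanSq]
    push_cast
    congr 1
    rw [← intervalIntegral.integral_ofReal]
    refine intervalIntegral.integral_congr fun θ _ => ?_
    simp only [Complex.mul_conj, Complex.normSq_eq_norm_sq, hF]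
  have hcoef : (fun n => ((‖hcoeff f n‖ ^ 2 * (r ^ n) ^ 2 : ℝ) : ℂ)) =
      fun n => (2 * Real.pi : ℂ)⁻¹ * (c n * ((starRingEnd ℂ) (c n) * (2 * Real.pi))) := by
    funext n
    have hpi : (Real.pi : ℂ) ≠ 0 := by exact_mod_cast Real.pi_ne_zero
    rw [← mul_assoc (c n), Complex.mul_conj, Complex.normSq_eq_norm_sq]
    simp only [hc, norm_mul, norm_pow, Complex.norm_real, Real.norm_eq_abs, abs_of_nonneg hr0]
    push_cast
    field_simp
  rw [hmean, hcoef]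
  exact h3

lemma tendsto_circleMeanSq {f : ℂ → ℂ} (a : SeqH2) (h : EqOn (powerEval a) f (ball 0 1)) :
    Tendsto (fun r => circleMeanSq r f) (𝓝[<] (1 : ℝ)) (𝓝 (‖a‖ ^ 2)) := by
  have hf : DifferentiableOn ℂ f (ball 0 1) := (memH2_of_eqOn h).1
  have hmem : Ico (0 : ℝ) 1 ∈ 𝓝[<] (1 : ℝ) := Ico_mem_nhdsLT one_pos
  have hlim : Tendsto (fun r : ℝ => ∑' n, ‖a n‖ ^ 2 * (r ^ n) ^ 2) (𝓝[<] (1 : ℝ))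
      (𝓝 (∑' n, ‖a n‖ ^ 2)) := by
    refine tendsto_tsum_of_dominated_convergence (bound := fun n => ‖a n‖ ^ 2)
      (hasSum_norm_sq a).summable (fun n => ?_) ?_
    · have hcont : Continuous fun r : ℝ => ‖a n‖ ^ 2 * (r ^ n) ^ 2 := by fun_prop
      simpa using (hcont.tendsto 1).mono_left nhdsWithin_le_nhds
    · filter_upwards [hmem] with r hr n
      rw [Real.norm_of_nonneg (by positivity)]
      exact mul_le_of_le_one_right (by positivity)
        (pow_le_one₀ (pow_nonneg hr.1 _) (pow_le_one₀ hr.1 hr.2.le))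
  rw [(hasSum_norm_sq a).tsum_eq] at hlim
  refine hlim.congr' ?_
  filter_upwards [hmem] with r hr
  rw [← (hasSum_circleMeanSq hf hr.1 hr.2).tsum_eq, hcoeff_eq_of_eqOn h]

lemma circleMeanSq_le {f : ℂ → ℂ} (a : SeqH2) (h : EqOn (powerEval a) f (ball 0 1)) {r : ℝ}
    (hr0 : 0 ≤ r) (hr : r < 1) : circleMeanSq r f ≤ ‖a‖ ^ 2 := by
  have hs := hasSum_circleMeanSq (memH2_of_eqOn h).1 hr0 hr
  rw [hcoeff_eq_of_eqOn h] at hs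
  refine hasSum_le (fun n => ?_) hs (hasSum_norm_sq a)
  exact mul_le_of_le_one_right (by positivity)
    (pow_le_one₀ (pow_nonneg hr0 _) (pow_le_one₀ hr0 hr.le))

lemma memH2_of_circleMeanSq_le {f : ℂ → ℂ} (hf : DifferentiableOn ℂ f (ball 0 1)) {K : ℝ}
    (h : ∀ r : ℝ, 0 ≤ r → r < 1 → circleMeanSq r f ≤ K) : MemH2 f := by
  refine ⟨hf, summable_of_sum_le (c := K) (fun n => by positivity) fun s => ?_⟩
  have hcont : Continuous fun r : ℝ => ∑ n ∈ s, ‖hcoeff f n‖ ^ 2 * (r ^ n) ^ 2 := by fun_prop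
  have hlim := (hcont.tendsto 1).mono_left (nhdsWithin_le_nhds (s := Iio (1 : ℝ)))
  simp only [one_pow, mul_one] at hlim
  refine le_of_tendsto hlim ?_
  filter_upwards [Ico_mem_nhdsLT (one_pos : (0 : ℝ) < 1)] with r hr
  exact (sum_le_hasSum s (fun n _ => by positivity) (hasSum_circleMeanSq hf hr.1 hr.2)).trans
    (h r hr.1 hr.2)

lemma circleMeanSq_mul_le {B f : ℂ → ℂ} (hB : DifferentiableOn ℂ B (ball 0 1))
    (hf : DifferentiableOn ℂ f (ball 0 1)) {C : ℝ} (hC : ∀ z ∈ ball (0 : ℂ) 1, ‖B z‖ ≤ C)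
    {r : ℝ} (hr0 : 0 ≤ r) (hr : r < 1) :
    circleMeanSq r (fun z => B z * f z) ≤ C ^ 2 * circleMeanSq r f := by
  have hfc := (continuous_circle hf hr0 hr).norm.pow 2
  have hBc := (continuous_circle (hB.mul hf) hr0 hr).norm.pow 2
  rw [circleMeanSq, circleMeanSq, mul_left_comm,
    ← intervalIntegral.integral_const_mul (C ^ 2)]
  gcongr
  refine intervalIntegral.integral_mono_on (by positivity) (hBc.intervalIntegrable _ _)
    ((continuous_const.mul hfc).intervalIntegrable _ _) fun θ _ => ?_
  simp only [norm_mul, mul_pow]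
  gcongr
  exact hC _ (mul_exp_mem_ball hr0 hr θ)

lemma exists_powerEval_mul {B : ℂ → ℂ} (hB : DifferentiableOn ℂ B (ball 0 1)) {C : ℝ}
    (hC : ∀ z ∈ ball (0 : ℂ) 1, ‖B z‖ ≤ C) (a : SeqH2) :
    ∃ b : SeqH2, EqOn (powerEval b) (fun z => B z * powerEval a z) (ball 0 1) ∧
      ‖b‖ ≤ C * ‖a‖ := by
  have hC0 : 0 ≤ C := (norm_nonneg _).trans (hC 0 (mem_ball_self one_pos))
  have ha := differentiableOn_powerEval a
  have hle : ∀ r : ℝ, 0 ≤ r → r < 1 →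
      circleMeanSq r (fun z => B z * powerEval a z) ≤ (C * ‖a‖) ^ 2 := fun r hr0 hr => by
    refine (circleMeanSq_mul_le hB ha hC hr0 hr).trans ?_
    rw [mul_pow]
    gcongr
    exact circleMeanSq_le a (fun _ _ => rfl) hr0 hr
  obtain ⟨b, hb⟩ := (memH2_of_circleMeanSq_le (hB.mul ha) hle).exists_powerEval
  refine ⟨b, hb, ?_⟩
  have hb2 : ‖b‖ ^ 2 ≤ (C * ‖a‖) ^ 2 := by
    refine le_of_tendsto (tendsto_circleMeanSq b hb) ?_
    filter_upwards [Ico_mem_nhdsLT (one_pos : (0 : ℝ) < 1)] with r hr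
    exact hle r hr.1 hr.2
  exact le_of_sq_le_sq hb2 (by positivity)

lemma exists_mulCLM {B : ℂ → ℂ} (hB : MemHinf B) :
    ∃ M : SeqH2 →L[ℂ] SeqH2,
      ∀ a, EqOn (powerEval (M a)) (fun z => B z * powerEval a z) (ball 0 1) := by
  obtain ⟨hd, C, hC⟩ := hB
  choose M hM hMC using exists_powerEval_mul hd hC
  refine ⟨LinearMap.mkContinuous
    { toFun := M
      map_add' := fun a b => powerEval_injOn fun z hz => ?_
      map_smul' := fun c a => powerEval_injOn fun z hz => ?_ } C hMC, hM⟩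
  · simp only [hM _ hz, powerEval_add _ _ hz, mul_add]
  · simp only [hM _ hz, powerEval_smul, RingHom.id_apply, mul_left_comm]

/-- Multiplication by a bounded analytic function, as an operator on `H²`. -/
def mulCLM (B : ℂ → ℂ) (hB : MemHinf B) : SeqH2 →L[ℂ] SeqH2 := (exists_mulCLM hB).choose

lemma powerEval_mulCLM {B : ℂ → ℂ} (hB : MemHinf B) (a : SeqH2) {z : ℂ}
    (hz : z ∈ ball (0 : ℂ) 1) : powerEval (mulCLM B hB a) z = B z * powerEval a z :=
  (exists_mulCLM hB).choose_spec a hz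

lemma mulCLM_comm {A B : ℂ → ℂ} (hA : MemHinf A) (hB : MemHinf B) (a : SeqH2) :
    mulCLM A hA (mulCLM B hB a) = mulCLM B hB (mulCLM A hA a) :=
  powerEval_injOn fun z hz => by simp only [powerEval_mulCLM _ _ hz, mul_left_comm]

lemma IsInner.tendsto_circleMeanSq_sub {u f : ℂ → ℂ} (hu : IsInner u) (hf : MemHinf f) :
    Tendsto (fun r => circleMeanSq r (fun z => u z * f z) - circleMeanSq r f)
      (𝓝[<] (1 : ℝ)) (𝓝 0) := by
  obtain ⟨⟨hud, C, hC⟩, hlim⟩ := hu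
  obtain ⟨hfd, K, hK⟩ := hf
  have hmem : Ico (0 : ℝ) 1 ∈ 𝓝[<] (1 : ℝ) := Ico_mem_nhdsLT one_pos
  have hint := intervalIntegral.tendsto_integral_filter_of_dominated_convergence
    (μ := volume) (a := 0) (b := 2 * Real.pi) (l := 𝓝[<] (1 : ℝ))
    (F := fun r θ => (‖u (r * Complex.exp (θ * Complex.I))‖ ^ 2 - 1) *
      ‖f (r * Complex.exp (θ * Complex.I))‖ ^ 2) (f := fun _ => (0 : ℝ))
    (fun _ => (C ^ 2 + 1) * K ^ 2) ?_ ?_ (by simp) ?_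
  · rw [intervalIntegral.integral_zero] at hint
    have h2 := hint.const_mul (2 * Real.pi)⁻¹
    rw [mul_zero] at h2
    refine h2.congr' ?_
    filter_upwards [hmem] with r hr
    have huc : Continuous fun θ : ℝ => ‖u (r * Complex.exp (θ * Complex.I)) *
        f (r * Complex.exp (θ * Complex.I))‖ ^ 2 :=
      (continuous_circle (hud.mul hfd) hr.1 hr.2).norm.pow 2
    have hfc : Continuous fun θ : ℝ => ‖f (r * Complex.exp (θ * Complex.I))‖ ^ 2 :=
      (continuous_circle hfd hr.1 hr.2).norm.pow 2
    rw [circleMeanSq, circleMeanSq, ← mul_sub,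
      ← intervalIntegral.integral_sub (huc.intervalIntegrable _ _) (hfc.intervalIntegrable _ _)]
    congr 1
    refine intervalIntegral.integral_congr fun θ _ => ?_
    simp only [norm_mul]
    ring
  · filter_upwards [hmem] with r hr
    exact ((((continuous_circle hud hr.1 hr.2).norm.pow 2).sub continuous_const).mul
      ((continuous_circle hfd hr.1 hr.2).norm.pow 2)).aestronglyMeasurable
  · filter_upwards [hmem] with r hr
    refine ae_of_all _ fun θ _ => ?_
    have hz := mul_exp_mem_ball hr.1 hr.2 θ
    rw [norm_mul, Real.norm_of_nonneg (sq_nonneg ‖f _‖)]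
    have h1 : ‖u (r * Complex.exp (θ * Complex.I))‖ ^ 2 ≤ C ^ 2 := by
      gcongr
      exact hC _ hz
    have h2 : ‖f (r * Complex.exp (θ * Complex.I))‖ ^ 2 ≤ K ^ 2 := by
      gcongr
      exact hK _ hz
    refine mul_le_mul ?_ h2 (by positivity) (by positivity)
    rw [Real.norm_eq_abs, abs_le]
    constructor <;> nlinarith [sq_nonneg ‖u (r * Complex.exp (θ * Complex.I))‖, sq_nonneg C]
  · filter_upwards [hlim] with θ hθ _
    obtain ⟨L, hL, ht⟩ := hθ
    have hu0 : Tendsto (fun r : ℝ => ‖u (r * Complex.exp (θ * Complex.I))‖ ^ 2 - 1)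
        (𝓝[<] (1 : ℝ)) (𝓝 0) := by
      simpa [hL] using (ht.norm.pow 2).sub_const 1
    refine hu0.zero_mul_isBoundedUnder_le ?_
    refine ⟨K ^ 2, ?_⟩
    rw [eventually_map]
    filter_upwards [hmem] with r hr
    have h2 := hK _ (mul_exp_mem_ball hr.1 hr.2 θ)
    simp only [Function.comp_apply, Real.norm_of_nonneg (sq_nonneg ‖f _‖)]
    gcongr

lemma IsInner.norm_mulCLM {u : ℂ → ℂ} (hu : IsInner u) (a : SeqH2) :
    ‖mulCLM u hu.1 a‖ = ‖a‖ := by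
  have hbdd : ∀ b : SeqH2, MemHinf (powerEval b) → ‖mulCLM u hu.1 b‖ = ‖b‖ := by
    intro b hb
    have h1 := (tendsto_circleMeanSq (f := fun z => u z * powerEval b z) (mulCLM u hu.1 b)
      fun z hz => powerEval_mulCLM _ _ hz).sub (tendsto_circleMeanSq b fun _ _ => rfl)
    have h2 := tendsto_nhds_unique h1 (hu.tendsto_circleMeanSq_sub hb)
    exact (pow_left_inj₀ (norm_nonneg _) (norm_nonneg _) two_ne_zero).1 (sub_eq_zero.1 h2)
  have hpoly : ∀ s : Finset ℕ, MemHinf (powerEval (∑ i ∈ s, lp.single 2 i (a i))) := by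
    intro s
    refine Finset.sum_induction _ (fun b : SeqH2 => MemHinf (powerEval b)) ?_ ?_ ?_
    · rintro b c ⟨-, K, hK⟩ ⟨-, L, hL⟩
      refine ⟨differentiableOn_powerEval _, K + L, fun z hz => ?_⟩
      rw [powerEval_add _ _ hz]
      exact (norm_add_le _ _).trans (add_le_add (hK z hz) (hL z hz))
    · exact ⟨differentiableOn_powerEval _, 0, fun z hz => by simp [powerEval]⟩
    · intro i _
      refine ⟨differentiableOn_powerEval _, ‖a i‖, fun z hz => ?_⟩
      rw [powerEval_single, norm_mul, norm_pow]
      exact mul_le_of_le_one_right (norm_nonneg _)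
        (pow_le_one₀ (norm_nonneg _) (by simpa using (mem_ball_zero_iff.1 hz).le))
  have hs := lp.hasSum_single (p := 2) (by simp) a
  have h1 := (((mulCLM u hu.1).continuous.tendsto a).comp hs).norm
  refine tendsto_nhds_unique h1 ?_
  refine Tendsto.congr (fun s => ?_) hs.norm
  exact (hbdd _ (hpoly s)).symm

lemma IsInner.inner_mulCLM {u : ℂ → ℂ} (hu : IsInner u) (a b : SeqH2) :
    inner ℂ (mulCLM u hu.1 a) (mulCLM u hu.1 b) = inner ℂ a b :=
  LinearIsometry.inner_map_map ⟨(mulCLM u hu.1).toLinearMap, hu.norm_mulCLM⟩ a b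

lemma isInner_id : IsInner fun z => z := by
  refine ⟨⟨differentiableOn_id, 1, fun z hz => (mem_ball_zero_iff.1 hz).le⟩,
    ae_of_all _ fun θ => ⟨Complex.exp (θ * Complex.I), Complex.norm_exp_ofReal_mul_I θ, ?_⟩⟩
  have hcont : Continuous fun r : ℝ => (r : ℂ) * Complex.exp (θ * Complex.I) := by fun_prop
  simpa using (hcont.tendsto 1).mono_left nhdsWithin_le_nhds

/-- The Szegő kernel at `w` is bounded and reproduces the value at `w`. -/
lemma exists_szego {w : ℂ} (hw : w ∈ ball (0 : ℂ) 1) :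
    ∃ k : SeqH2, MemHinf (powerEval k) ∧ ∀ a : SeqH2, inner ℂ k a = powerEval a w := by
  have hw1 : ‖w‖ < 1 := mem_ball_zero_iff.1 hw
  have hsum : Summable fun n : ℕ => ‖(starRingEnd ℂ) w ^ n‖ := by
    simpa using summable_geometric_of_lt_one (norm_nonneg w) hw1
  have hm : Memℓp (fun n : ℕ => (starRingEnd ℂ) w ^ n) 2 := by
    refine (memℓp_gen_iff (by simp)).2 ?_
    have := summable_geometric_of_lt_one (sq_nonneg ‖w‖)
      (pow_lt_one₀ (norm_nonneg w) hw1 two_ne_zero)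
    refine this.congr fun n => ?_
    simp [← pow_mul, mul_comm]
  refine ⟨⟨_, hm⟩, ⟨differentiableOn_powerEval _, ∑' n : ℕ, ‖(starRingEnd ℂ) w ^ n‖,
    fun z hz => ?_⟩, fun a => ?_⟩
  · refine tsum_of_norm_bounded hsum.hasSum fun n => ?_
    rw [norm_mul, norm_pow z]
    exact mul_le_of_le_one_right (norm_nonneg _)
      (pow_le_one₀ (norm_nonneg _) (mem_ball_zero_iff.1 hz).le)
  · rw [lp.inner_eq_tsum]
    simp [powerEval]

lemma mem_KSpace_iff {Θ f : ℂ → ℂ} (hΘ : MemHinf Θ) {a : SeqH2}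
    (h : EqOn (powerEval a) f (ball 0 1)) :
    f ∈ KSpace Θ ↔ ∀ b : SeqH2, inner ℂ (mulCLM Θ hΘ b) a = 0 := by
  constructor
  · rintro ⟨-, hf⟩ b
    rw [← hInner_eq_inner (fun z hz => powerEval_mulCLM hΘ b hz) h]
    exact hf _ (memH2_powerEval b)
  · intro hf
    refine ⟨memH2_of_eqOn h, fun g hg => ?_⟩
    obtain ⟨b, hb⟩ := hg.exists_powerEval
    rw [hInner_eq_inner (a := mulCLM Θ hΘ b) (fun z hz => ?_) h]
    · exact hf b
    · rw [powerEval_mulCLM hΘ b hz, hb hz]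

lemma inner_single_zero_one (a : SeqH2) : inner ℂ (lp.single 2 0 1) a = a 0 := by
  simp [lp.inner_single_left]

lemma inner_right_single_zero_one (a : SeqH2) :
    inner ℂ a (lp.single 2 0 1) = (starRingEnd ℂ) (a 0) := by
  rw [← inner_conj_symm, inner_single_zero_one]

lemma powerEval_single_zero_one (z : ℂ) : powerEval (lp.single 2 0 1) z = 1 := by
  simp [powerEval_single]

lemma mulCLM_apply_zero {B : ℂ → ℂ} (hB : MemHinf B) (a : SeqH2) :
    mulCLM B hB a 0 = B 0 * a 0 := by
  rw [← powerEval_zero, powerEval_mulCLM hB a (mem_ball_self one_pos), powerEval_zero]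

/-- A sequence with vanishing constant term is a right shift. -/
lemma exists_mulCLM_id_eq {a : SeqH2} (ha : a 0 = 0) :
    ∃ b : SeqH2, mulCLM (fun z => z) isInner_id.1 b = a := by
  have hs : Summable fun n => ‖a (n + 1)‖ ^ 2 :=
    (summable_nat_add_iff 1).2 (hasSum_norm_sq a).summable
  have hm : Memℓp (fun n => a (n + 1)) 2 := (memℓp_gen_iff (by simp)).2 (by simpa using hs)
  refine ⟨⟨_, hm⟩, powerEval_injOn fun z hz => ?_⟩
  rw [powerEval_mulCLM _ _ hz, powerEval, powerEval,
    (summable_powerEval a hz).tsum_eq_zero_add, ha, ← tsum_mul_left]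
  simp only [zero_mul, zero_add]
  refine tsum_congr fun n => ?_
  rw [pow_succ]
  ring

/-- If `u · F` and `v` agree on the disk for inner `u`, `v` and `F ∈ H²`, then `|F| ≤ 1` on the
disk. -/
lemma norm_powerEval_le_one {u v : ℂ → ℂ} (hu : IsInner u) (hv : IsInner v) {a : SeqH2}
    (h : ∀ z ∈ ball (0 : ℂ) 1, v z = u z * powerEval a z) {w : ℂ} (hw : w ∈ ball (0 : ℂ) 1) :
    ‖powerEval a w‖ ≤ 1 := by
  obtain ⟨k, hk, hka⟩ := exists_szego hw
  have hmul : mulCLM u hu.1 (mulCLM _ hk a) = mulCLM v hv.1 k := powerEval_injOn fun z hz => by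
    rw [powerEval_mulCLM _ _ hz, powerEval_mulCLM _ _ hz, powerEval_mulCLM _ _ hz, h z hz]
    ring
  have hnorm : ‖mulCLM _ hk a‖ = ‖k‖ := by
    rw [← hu.norm_mulCLM, hmul, hv.norm_mulCLM]
  have hkk : powerEval k w = (‖k‖ : ℂ) ^ 2 := by
    rw [← hka, inner_self_eq_norm_sq_to_K]
    rfl
  have hle : ‖k‖ ^ 2 * ‖powerEval a w‖ ≤ ‖k‖ ^ 2 := by
    have h1 := norm_inner_le_norm (𝕜 := ℂ) k (mulCLM _ hk a)
    rw [hka, powerEval_mulCLM _ _ hw, hnorm, norm_mul, hkk] at h1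
    simpa [pow_two] using h1
  have hk0 : 0 < ‖k‖ := by
    rw [norm_pos_iff]
    rintro rfl
    have h1 := hka (lp.single 2 0 1)
    rw [powerEval_single_zero_one, inner_zero_left] at h1
    exact zero_ne_one h1
  exact le_of_mul_le_mul_left (by simpa using hle) (pow_pos hk0 2)

lemma isInner_one : IsInner fun _ => 1 :=
  ⟨⟨differentiableOn_const _, 1, fun _ _ => by simp⟩,
    ae_of_all _ fun _ => ⟨1, norm_one, tendsto_const_nhds⟩⟩

lemma IsInner.norm_le_one {u : ℂ → ℂ} (hu : IsInner u) {w : ℂ} (hw : w ∈ ball (0 : ℂ) 1) :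
    ‖u w‖ ≤ 1 := by
  have h : ∀ z ∈ ball (0 : ℂ) 1, powerEval (mulCLM u hu.1 (lp.single 2 0 1)) z = u z :=
    fun z hz => by rw [powerEval_mulCLM _ _ hz, powerEval_single_zero_one, mul_one]
  rw [← h w hw]
  exact norm_powerEval_le_one isInner_one hu (fun z hz => by rw [h z hz, one_mul]) hw

lemma IsInner.eqOn_of_one_le_norm {u : ℂ → ℂ} (hu : IsInner u) (h : 1 ≤ ‖u 0‖) :
    ∀ z ∈ ball (0 : ℂ) 1, u z = u 0 := by
  have := Complex.eqOn_of_isPreconnected_of_isMaxOn_norm (convex_ball (0 : ℂ) 1).isPreconnected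
    isOpen_ball hu.1.1 (mem_ball_self one_pos) fun z hz => (hu.norm_le_one hz).trans h
  exact this

lemma const_mem_Mult_of_dvd {u v I : ℂ → ℂ} (hu : IsInner u) (hv : IsInner v) (hI : IsInner I)
    (h : ∀ z ∈ ball (0 : ℂ) 1, v z = u z * I z) (c : ℂ) : (fun _ => c) ∈ Mult u v := by
  refine ⟨differentiableOn_const _, fun f hf => ?_⟩
  obtain ⟨a, ha⟩ := hf.1.exists_powerEval
  rw [mem_KSpace_iff hv.1 (a := c • a) fun z hz => by simp only [powerEval_smul, ha hz]]
  intro b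
  have hb : mulCLM v hv.1 b = mulCLM u hu.1 (mulCLM I hI.1 b) := powerEval_injOn fun z hz => by
    rw [powerEval_mulCLM _ _ hz, powerEval_mulCLM _ _ hz, powerEval_mulCLM _ _ hz, h z hz,
      mul_assoc]
  rw [inner_smul_right, hb, (mem_KSpace_iff hu.1 ha).1 hf, mul_zero]

lemma dvd_of_one_mem_Mult {u v : ℂ → ℂ} (hu : IsInner u) (hv : IsInner v)
    (h : (fun _ => 1) ∈ Mult u v) :
    ∃ I : ℂ → ℂ, IsInner I ∧ ∀ z ∈ ball (0 : ℂ) 1, v z = u z * I z := by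
  set U : Submodule ℂ SeqH2 := LinearMap.range (mulCLM u hu.1).toLinearMap
  have hclosed : IsClosed (U : Set SeqH2) := by
    have hiso : Isometry (mulCLM u hu.1) :=
      AddMonoidHomClass.isometry_of_norm _ hu.norm_mulCLM
    have hcoe : (U : Set SeqH2) = range (mulCLM u hu.1) := LinearMap.coe_range _
    rw [hcoe]
    exact hiso.isClosedEmbedding.isClosed_range
  have : CompleteSpace U := hclosed.completeSpace_coe
  have hmem : mulCLM v hv.1 (lp.single 2 0 1) ∈ U := by
    rw [← Submodule.orthogonal_orthogonal U, Submodule.mem_orthogonal']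
    intro a ha
    rw [Submodule.mem_orthogonal] at ha
    have hau : powerEval a ∈ KSpace u :=
      (mem_KSpace_iff hu.1 fun _ _ => rfl).2 fun b => ha _ ⟨b, rfl⟩
    exact (mem_KSpace_iff hv.1 fun z _ => (one_mul (powerEval a z)).symm).1 (h.2 _ hau) _
  obtain ⟨a, ha⟩ := hmem
  have hva : ∀ z ∈ ball (0 : ℂ) 1, v z = u z * powerEval a z := fun z hz => by
    rw [← powerEval_mulCLM hu.1 a hz]
    have h1 := powerEval_mulCLM hv.1 (lp.single 2 0 1) hz
    rw [powerEval_single_zero_one, mul_one] at h1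
    rw [← h1]
    exact congrArg (fun b => powerEval b z) ha.symm
  refine ⟨powerEval a, ⟨⟨differentiableOn_powerEval a, 1,
    fun z hz => norm_powerEval_le_one hu hv hva hz⟩, ?_⟩, hva⟩
  filter_upwards [hu.2, hv.2] with θ ⟨L, hL, hLt⟩ ⟨L', hL', hLt'⟩
  have hL0 : L ≠ 0 := norm_ne_zero_iff.1 (by rw [hL]; exact one_ne_zero)
  refine ⟨L' / L, by rw [norm_div, hL, hL', div_one], ?_⟩
  refine (hLt'.div hLt hL0).congr' ?_
  filter_upwards [hLt.eventually_ne hL0, Ico_mem_nhdsLT (one_pos : (0 : ℝ) < 1)] with r hr hr1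
  simp only [Pi.div_apply]
  rw [hva _ (mul_exp_mem_ball hr1.1 hr1.2 θ), mul_div_cancel_left₀ _ hr]

lemma one_sub_conj_mul_mem_KSpace {v : ℂ → ℂ} (hv : IsInner v) :
    (fun z => 1 - (starRingEnd ℂ) (v 0) * v z) ∈ KSpace v := by
  rw [mem_KSpace_iff hv.1 (a := lp.single 2 0 1 -
    (starRingEnd ℂ) (v 0) • mulCLM v hv.1 (lp.single 2 0 1)) fun z hz => by
      simp only [powerEval_sub _ _ hz, powerEval_smul, powerEval_mulCLM _ _ hz,
        powerEval_single_zero_one, mul_one]]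
  intro b
  rw [inner_sub_right, inner_smul_right, hv.inner_mulCLM, inner_right_single_zero_one,
    inner_right_single_zero_one, mulCLM_apply_zero, map_mul, sub_self]

lemma exists_bShift_mem_KSpace {v : ℂ → ℂ} (hv : IsInner v) :
    ∃ f ∈ KSpace v, ∀ z ∈ ball (0 : ℂ) 1, z * f z = v z - v 0 := by
  set V := mulCLM v hv.1 (lp.single 2 0 1) with hV
  have h0 : (V - v 0 • lp.single 2 0 (1 : ℂ) : SeqH2) 0 = 0 := by
    have h1 : V 0 = v 0 := by simp [hV, mulCLM_apply_zero]
    rw [lp.coeFn_sub, Pi.sub_apply, h1]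
    simp
  obtain ⟨a, ha⟩ := exists_mulCLM_id_eq h0
  refine ⟨powerEval a, (mem_KSpace_iff hv.1 fun _ _ => rfl).2 fun b => ?_, fun z hz => ?_⟩
  · rw [← isInner_id.inner_mulCLM, ha, mulCLM_comm, inner_sub_right, inner_smul_right,
      hV, hv.inner_mulCLM, inner_right_single_zero_one, inner_right_single_zero_one]
    simp [mulCLM_apply_zero]
  · rw [← powerEval_mulCLM isInner_id.1 a hz, ha, powerEval_sub _ _ hz, powerEval_smul,
      hV, powerEval_mulCLM _ _ hz, powerEval_single_zero_one, mul_one, mul_one]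

lemma memHinf_inv_one_sub {v : ℂ → ℂ} (hv : IsInner v) (h0 : ‖v 0‖ < 1) :
    MemHinf (fun z => (1 - (starRingEnd ℂ) (v 0) * v z)⁻¹) ∧
      ∀ z ∈ ball (0 : ℂ) 1, 1 - (starRingEnd ℂ) (v 0) * v z ≠ 0 := by
  have hlow : ∀ z ∈ ball (0 : ℂ) 1, 1 - ‖v 0‖ ≤ ‖1 - (starRingEnd ℂ) (v 0) * v z‖ := by
    intro z hz
    have h1 := norm_sub_norm_le (1 : ℂ) ((starRingEnd ℂ) (v 0) * v z)
    rw [norm_one, norm_mul, RCLike.norm_conj] at h1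
    nlinarith [hv.norm_le_one hz, norm_nonneg (v 0)]
  have hpos : 0 < 1 - ‖v 0‖ := sub_pos.2 h0
  have hne : ∀ z ∈ ball (0 : ℂ) 1, 1 - (starRingEnd ℂ) (v 0) * v z ≠ 0 := fun z hz =>
    norm_pos_iff.1 (hpos.trans_le (hlow z hz))
  refine ⟨⟨((differentiableOn_const _).sub (hv.1.1.const_mul _)).inv hne, (1 - ‖v 0‖)⁻¹,
    fun z hz => ?_⟩, hne⟩
  rw [norm_inv]
  exact inv_anti₀ hpos (hlow z hz)

/-- A multiplier from `K_v` to `K_u`, where `v = u I` is nonconstant, becomes constant after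
multiplication by `I`. -/
lemma exists_mulCLM_eq_single_of_mem_Mult {u v I φ : ℂ → ℂ} (hu : IsInner u) (hv : IsInner v)
    (hI : IsInner I) (h : ∀ z ∈ ball (0 : ℂ) 1, v z = u z * I z) (hv0 : ‖v 0‖ < 1)
    (hφ : φ ∈ Mult v u) :
    ∃ (a : SeqH2) (c : ℂ), EqOn (powerEval a) φ (ball 0 1) ∧
      mulCLM I hI.1 a = c • lp.single 2 0 (1 : ℂ) := by
  obtain ⟨hW, hne⟩ := memHinf_inv_one_sub hv hv0
  set S := mulCLM (fun z => z) isInner_id.1 with hS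
  obtain ⟨P, hP⟩ := (hφ.2 _ (one_sub_conj_mul_mem_KSpace hv)).1.exists_powerEval
  set a := mulCLM _ hW P with ha_def
  have ha : EqOn (powerEval a) φ (ball 0 1) := fun z hz => by
    rw [ha_def, powerEval_mulCLM _ _ hz, hP hz]
    have := hne z hz
    field_simp
  obtain ⟨f, hf, hfz⟩ := exists_bShift_mem_KSpace hv
  have hφf := hφ.2 f hf
  obtain ⟨F, hF⟩ := hφf.1.exists_powerEval
  have hort := (mem_KSpace_iff hu.1 hF).1 hφf
  set b := mulCLM I hI.1 a with hb
  have hSF : S (mulCLM I hI.1 F) = mulCLM v hv.1 b - v 0 • b := powerEval_injOn fun z hz => by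
    simp only [hS, hb, powerEval_sub _ _ hz, powerEval_smul, powerEval_mulCLM _ _ hz, hF hz,
      ha hz]
    linear_combination (I z * φ z) * hfz z hz
  have hSg : ∀ g, S (mulCLM I hI.1 (mulCLM u hu.1 g)) = mulCLM v hv.1 (S g) := fun g =>
    powerEval_injOn fun z hz => by
      simp only [hS, powerEval_mulCLM _ _ hz, h z hz]
      ring
  have hrel : ∀ g, inner ℂ (S g) b = v 0 * inner ℂ (mulCLM v hv.1 (S g)) b := fun g => by
    have h1 := hort g
    rw [← hI.inner_mulCLM, ← isInner_id.inner_mulCLM, ← hS, hSF, hSg, inner_sub_right,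
      inner_smul_right, hv.inner_mulCLM] at h1
    exact sub_eq_zero.1 h1
  have hperp : ∀ g, inner ℂ (S g) b = 0 := fun g => by
    have hg : S g = S (mulCLM _ hW g) -
        (starRingEnd ℂ) (v 0) • mulCLM v hv.1 (S (mulCLM _ hW g)) := powerEval_injOn fun z hz => by
      simp only [hS, powerEval_sub _ _ hz, powerEval_smul, powerEval_mulCLM _ _ hz]
      have := hne z hz
      field_simp
    rw [hg, inner_sub_left, inner_smul_left, Complex.conj_conj, hrel, sub_self]
  refine ⟨a, b 0, ha, ?_⟩
  have h0 : (b - b 0 • lp.single 2 0 (1 : ℂ) : SeqH2) 0 = 0 := by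
    rw [lp.coeFn_sub, Pi.sub_apply]
    simp
  obtain ⟨g, hg⟩ := exists_mulCLM_id_eq h0
  rw [← sub_eq_zero, ← inner_self_eq_zero (𝕜 := ℂ)]
  nth_rewrite 1 [← hg]
  rw [inner_sub_right, inner_smul_right, inner_right_single_zero_one, ← hS, hperp, hS,
    mulCLM_apply_zero isInner_id.1 g]
  simp

lemma eqOn_zero_of_mem_Mult {u v I φ : ℂ → ℂ} (hu : IsInner u) (hv : IsInner v)
    (hI : IsInner I) (h : ∀ z ∈ ball (0 : ℂ) 1, v z = u z * I z) (hI0 : ‖I 0‖ < 1)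
    (hφ : φ ∈ Mult v u) : ∀ z ∈ ball (0 : ℂ) 1, φ z = 0 := by
  have h00 : (0 : ℂ) ∈ ball (0 : ℂ) 1 := mem_ball_self one_pos
  have hv0 : ‖v 0‖ < 1 := by
    rw [h 0 h00, norm_mul]
    exact (mul_le_of_le_one_left (norm_nonneg _) (hu.norm_le_one h00)).trans_lt hI0
  obtain ⟨a, c, ha, hac⟩ := exists_mulCLM_eq_single_of_mem_Mult hu hv hI h hv0 hφ
  have hnorm : ‖a‖ = ‖c‖ := by
    rw [← hI.norm_mulCLM, hac, norm_smul, lp.norm_single (by simp), norm_one, mul_one]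
  have hc : I 0 * a 0 = c := by
    rw [← mulCLM_apply_zero hI.1, hac]
    simp
  have ha0 : a = 0 := by
    have h1 : ‖c‖ ≤ ‖I 0‖ * ‖a‖ := by
      rw [← hc, norm_mul]
      gcongr
      exact lp.norm_apply_le_norm (by simp) a 0
    rw [← hnorm] at h1
    rw [← norm_le_zero_iff]
    nlinarith [norm_nonneg a]
  intro z hz
  rw [← ha hz, ha0]
  simp [powerEval]

lemma zero_mem_Mult {u v φ : ℂ → ℂ} (hu : IsInner u) (hφ : DifferentiableOn ℂ φ (ball 0 1))
    (h : ∀ z ∈ ball (0 : ℂ) 1, φ z = 0) : φ ∈ Mult v u := by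
  refine ⟨hφ, fun f _ => ?_⟩
  rw [mem_KSpace_iff hu.1 (a := 0) fun z hz => by simp [powerEval, h z hz]]
  simp

/-- (a) Every constant function belongs to `𝓜(u,v)` iff `u` divides `v`;
(b) if `u` divides `v` and `u` is not a unimodular constant multiple of `v`,
then `𝓜(v,u) = {0}`. -/
theorem stmt_1 (u v : ℂ → ℂ) (hu : IsInner u) (hv : IsInner v) :
    ((∀ c : ℂ, (fun _ => c) ∈ Mult u v) ↔
      ∃ I : ℂ → ℂ, IsInner I ∧ ∀ z ∈ ball (0 : ℂ) 1, v z = u z * I z) ∧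
    ((∃ I : ℂ → ℂ, IsInner I ∧ ∀ z ∈ ball (0 : ℂ) 1, v z = u z * I z) →
      (¬ ∃ c : ℂ, ‖c‖ = 1 ∧ ∀ z ∈ ball (0 : ℂ) 1, u z = c * v z) →
      Mult v u =
        {φ | DifferentiableOn ℂ φ (ball (0 : ℂ) 1) ∧ ∀ z ∈ ball (0 : ℂ) 1, φ z = 0}) := by
  refine ⟨⟨fun h => dvd_of_one_mem_Mult hu hv (h 1), fun ⟨I, hI, h⟩ =>
    const_mem_Mult_of_dvd hu hv hI h⟩, ?_⟩
  rintro ⟨I, hI, h⟩ hne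
  have hI0 : ‖I 0‖ < 1 := by
    by_contra! hge
    have hnorm : ‖I 0‖ = 1 := le_antisymm (hI.norm_le_one (mem_ball_self one_pos)) hge
    have hI0 : I 0 ≠ 0 := norm_ne_zero_iff.1 (by rw [hnorm]; exact one_ne_zero)
    refine hne ⟨(I 0)⁻¹, by rw [norm_inv, hnorm, inv_one], fun z hz => ?_⟩
    rw [h z hz, hI.eqOn_of_one_le_norm hge z hz]
    field_simp
  ext φ
  exact ⟨fun hφ => ⟨hφ.1, eqOn_zero_of_mem_Mult hu hv hI h hI0 hφ⟩,
    fun hφ => zero_mem_Mult hu hφ.1 hφ.2⟩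

end
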